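/- For all n×n positive definite matrices X, Y, Z with Tr[Z] = Tr[X], all s ∈ [0,1] and all r > 0, Tr[X log(Y^r #_s Z^r)] ≤ Tr[X (s log X^r + (1-s) log Y^r)]. -/

import Mathlib

open Matrix ComplexOrder

noncomputable def mlog {n : Type*} [Fintype n] [DecidableEq n] (A : Matrix n n ℂ) : Matrix n n ℂ :=
  cfc Real.log A

noncomputable def mpow {n : Type*} [Fintype n] [DecidableEq n] (A : Matrix n n ℂ) (p : ℝ) :
    Matrix n n ℂ :=
  cfc (fun x : ℝ => x ^ p) A

noncomputable def rtr {n : Type*} [Fintype n] [DecidableEq n] (A : Matrix n n ℂ) : ℝ :=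
  A.trace.re

/-- The weighted geometric mean `A #_t B = A^{1/2} (A^{-1/2} B A^{-1/2})^t A^{1/2}`,
defined for all real `t`. -/
noncomputable def gm {n : Type*} [Fintype n] [DecidableEq n] (A B : Matrix n n ℂ) (t : ℝ) :
    Matrix n n ℂ :=
  mpow A (1 / 2) * mpow (mpow A (-(1 / 2)) * B * mpow A (-(1 / 2))) t * mpow A (1 / 2)

section

variable {n : Type*} [Fintype n] [DecidableEq n]

lemma rtr_cfc {A : Matrix n n ℂ} (hA : A.IsHermitian) (f : ℝ → ℝ) :
    rtr (cfc f A) = ∑ i, f (hA.eigenvalues i) := by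
  rw [rtr, hA.cfc_eq, IsHermitian.cfc, Unitary.conjStarAlgAut_apply, Matrix.trace_mul_cycle]
  simp [Matrix.trace]

lemma continuousOn_spectrum {A : Matrix n n ℂ} (f : ℝ → ℝ) :
    ContinuousOn f (spectrum ℝ A) :=
  A.finite_real_spectrum.continuousOn f

lemma spectrum_pos {A : Matrix n n ℂ} (hA : A.PosDef) {x : ℝ} (hx : x ∈ spectrum ℝ A) :
    0 < x := by
  rw [hA.1.spectrum_real_eq_range_eigenvalues] at hx
  obtain ⟨i, rfl⟩ := hx
  exact hA.eigenvalues_pos i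

lemma mlog_mpow {A : Matrix n n ℂ} (hA : A.PosDef) (p : ℝ) : mlog (mpow A p) = p • mlog A := by
  rw [mlog, mpow, mlog, ← cfc_comp' Real.log (fun x => x ^ p) A
    ((A.finite_real_spectrum.image _).continuousOn _) (continuousOn_spectrum _) hA.1.isSelfAdjoint,
    ← cfc_smul p _ A (continuousOn_spectrum _)]
  refine cfc_congr fun x hx => ?_
  simp [Real.log_rpow (spectrum_pos hA hx)]

lemma mpow_smul_mpow_neg_one {A : Matrix n n ℂ} (hA : A.PosDef) {c : ℝ} (hc : 0 < c) (s : ℝ) :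
    mpow (c • mpow A (-1)) s = c ^ s • mpow A (-s) := by
  unfold mpow
  rw [← cfc_smul c _ A (continuousOn_spectrum _),
    ← cfc_smul (c ^ s) _ A (continuousOn_spectrum _),
    ← cfc_comp' (fun x => x ^ s) _ A ((A.finite_real_spectrum.image _).continuousOn _)
      (continuousOn_spectrum _) hA.1.isSelfAdjoint]
  refine cfc_congr fun x hx => ?_
  have := spectrum_pos hA hx
  simp only [smul_eq_mul]
  rw [Real.mul_rpow hc.le (by positivity), ← Real.rpow_mul this.le, neg_one_mul]

lemma rtr_mul_mlog {A : Matrix n n ℂ} (hA : A.IsHermitian) :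
    rtr (A * mlog A) = ∑ i, hA.eigenvalues i * Real.log (hA.eigenvalues i) := by
  rw [← rtr_cfc hA (fun x => x * Real.log x), cfc_mul (fun x => x) _ A
    (continuousOn_spectrum _) (continuousOn_spectrum _), cfc_id' ℝ A hA.isSelfAdjoint, mlog]

end

section

open scoped MatrixOrder Matrix.Norms.L2Operator

variable {n : Type*} [Fintype n] [DecidableEq n]

lemma mpow_eq_rpow {A : Matrix n n ℂ} (hA : A.PosDef) (p : ℝ) : mpow A p = A ^ p :=
  (CFC.rpow_eq_cfc_real hA.posSemidef.nonneg).symm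

lemma det_cfc {A : Matrix n n ℂ} (hA : A.IsHermitian) (f : ℝ → ℝ) :
    (cfc f A).det = ((∏ i, f (hA.eigenvalues i) : ℝ) : ℂ) := by
  rw [hA.cfc_eq, IsHermitian.cfc, Unitary.conjStarAlgAut_apply, Matrix.det_mul_right_comm]
  simp

lemma re_det_eq_prod_eigenvalues {A : Matrix n n ℂ} (hA : A.IsHermitian) :
    A.det.re = ∏ i, hA.eigenvalues i := by
  rw [hA.det_eq_prod_eigenvalues]
  norm_cast

lemma rtr_mlog {A : Matrix n n ℂ} (hA : A.PosDef) : rtr (mlog A) = Real.log A.det.re := by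
  rw [mlog, rtr_cfc hA.1, re_det_eq_prod_eigenvalues hA.1, Real.log_prod]
  exact fun i _ => (hA.eigenvalues_pos i).ne'

lemma re_det_pos {A : Matrix n n ℂ} (hA : A.PosDef) : 0 < A.det.re := by
  rw [re_det_eq_prod_eigenvalues hA.1]
  exact Finset.prod_pos fun i _ => hA.eigenvalues_pos i

lemma det_mpow {A : Matrix n n ℂ} (hA : A.PosDef) (p : ℝ) :
    (mpow A p).det = ((A.det.re ^ p : ℝ) : ℂ) := by
  rw [mpow, det_cfc hA.1, re_det_eq_prod_eigenvalues hA.1, Real.finsetProd_rpow]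
  exact fun i _ => (hA.eigenvalues_pos i).le

lemma posDef_mpow {A : Matrix n n ℂ} (hA : A.PosDef) (p : ℝ) : (mpow A p).PosDef := by
  rw [mpow_eq_rpow hA]
  rw [← isStrictlyPositive_iff_posDef] at hA ⊢
  exact hA.rpow A p

lemma mlog_le_mlog {A B : Matrix n n ℂ} (hA : A.PosDef) (hAB : A ≤ B) : mlog A ≤ mlog B :=
  CFC.log_le_log hAB (isStrictlyPositive_iff_posDef.2 hA)

lemma mlog_smul {A : Matrix n n ℂ} (hA : A.PosDef) {c : ℝ} (hc : 0 < c) :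
    mlog (c • A) = Real.log c • (1 : Matrix n n ℂ) + mlog A := by
  rw [← Algebra.algebraMap_eq_smul_one]
  exact CFC.log_smul' A hc (isStrictlyPositive_iff_posDef.2 hA)

lemma posDef_mpow_conj {A B : Matrix n n ℂ} (hA : A.PosDef) (hB : B.PosDef) (p : ℝ) :
    (mpow A p * B * mpow A p).PosDef := by
  have h := posDef_mpow hA p
  have := hB.conjTranspose_mul_mul_same (B := mpow A p)
    (Matrix.mulVec_injective_of_isUnit h.isUnit)
  rwa [h.1.eq] at this

lemma posDef_gm {A B : Matrix n n ℂ} (hA : A.PosDef) (hB : B.PosDef) (s : ℝ) :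
    (gm A B s).PosDef :=
  posDef_mpow_conj hA (posDef_mpow (posDef_mpow_conj hA hB _) s) _

lemma re_det_gm {A B : Matrix n n ℂ} (hA : A.PosDef) (hB : B.PosDef) (s : ℝ) :
    (gm A B s).det.re = A.det.re ^ (1 - s) * B.det.re ^ s := by
  have ha := re_det_pos hA
  have hb := re_det_pos hB
  have hB' : B.det = (B.det.re : ℂ) := by
    rw [re_det_eq_prod_eigenvalues hB.1, hB.1.det_eq_prod_eigenvalues]
    norm_cast
  have h1 : (mpow A (-(1 / 2)) * B * mpow A (-(1 / 2))).det.re = A.det.re⁻¹ * B.det.re := by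
    rw [det_mul, det_mul, det_mpow hA, hB']
    norm_cast
    rw [mul_right_comm, ← Real.rpow_add ha]
    norm_num [Real.rpow_neg_one]
  rw [gm, det_mul, det_mul, det_mpow hA, det_mpow (posDef_mpow_conj hA hB _), h1]
  norm_cast
  rw [mul_right_comm, ← Real.rpow_add ha, Real.mul_rpow (by positivity) hb.le,
    Real.inv_rpow ha.le, Real.rpow_sub ha]
  norm_num
  ring

lemma rtr_mlog_gm {A B : Matrix n n ℂ} (hA : A.PosDef) (hB : B.PosDef) (s : ℝ) :
    rtr (mlog (gm A B s)) = (1 - s) * rtr (mlog A) + s * rtr (mlog B) := by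
  have ha := re_det_pos hA
  have hb := re_det_pos hB
  rw [rtr_mlog (posDef_gm hA hB s), rtr_mlog hA, rtr_mlog hB, re_det_gm hA hB,
    Real.log_mul (by positivity) (by positivity), Real.log_rpow ha, Real.log_rpow hb]

lemma gm_le_gm {A B C : Matrix n n ℂ} (hA : A.PosDef) (hB : B.PosDef) (hC : C.PosDef)
    (hBC : B ≤ C) {s : ℝ} (hs : s ∈ Set.Icc (0 : ℝ) 1) : gm A B s ≤ gm A C s := by
  rw [gm, gm]
  refine IsSelfAdjoint.conjugate_le_conjugate ?_ (posDef_mpow hA _).1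
  rw [mpow_eq_rpow (posDef_mpow_conj hA hB _), mpow_eq_rpow (posDef_mpow_conj hA hC _)]
  exact CFC.rpow_le_rpow hs (IsSelfAdjoint.conjugate_le_conjugate hBC (posDef_mpow hA _).1)

lemma mpow_mul_mpow {A : Matrix n n ℂ} (hA : A.PosDef) (p q : ℝ) :
    mpow A p * mpow A q = mpow A (p + q) := by
  simp only [mpow_eq_rpow hA, CFC.rpow_add hA.isUnit]

lemma gm_smul_one {A : Matrix n n ℂ} (hA : A.PosDef) {c : ℝ} (hc : 0 < c) (s : ℝ) :
    gm A (c • 1) s = c ^ s • mpow A (1 - s) := by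
  rw [gm, mul_smul_comm, mul_one, smul_mul_assoc, mpow_mul_mpow hA,
    show -(1 / 2 : ℝ) + -(1 / 2) = -1 by norm_num, mpow_smul_mpow_neg_one hA hc,
    mul_smul_comm, smul_mul_assoc, mpow_mul_mpow hA, mpow_mul_mpow hA]
  congr 2
  ring

lemma smul_mlog_le_mlog_gm {A C : Matrix n n ℂ} (hA : A.PosDef) (hC : C.PosDef) {c : ℝ}
    (hc : 0 < c) (hcC : c • 1 ≤ C) {s : ℝ} (hs : s ∈ Set.Icc (0 : ℝ) 1) :
    (s * Real.log c) • 1 + (1 - s) • mlog A ≤ mlog (gm A C s) := by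
  have h1 : (c • (1 : Matrix n n ℂ)).PosDef := PosDef.one.smul hc
  have h := mlog_le_mlog (posDef_gm hA h1 s) (gm_le_gm hA h1 hC hcC hs)
  rwa [gm_smul_one hA hc, mlog_smul (posDef_mpow hA _) (by positivity), mlog_mpow hA,
    Real.log_rpow hc] at h

lemma mlog_gm_sub_le {A B C : Matrix n n ℂ} (hA : A.PosDef) (hB : B.PosDef) (hC : C.PosDef)
    (hBC : B ≤ C) {s : ℝ} (hs : s ∈ Set.Icc (0 : ℝ) 1) :
    mlog (gm A B s) - (1 - s) • mlog A ≤ mlog (gm A C s) - (1 - s) • mlog A :=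
  sub_le_sub_right (mlog_le_mlog (posDef_gm hA hB s) (gm_le_gm hA hB hC hBC hs)) _

/-- The real part of the `i`-th diagonal entry of `U* M U`. -/
noncomputable def conjDiag (U M : Matrix n n ℂ) (i : n) : ℝ :=
  ((star U * M * U) i i).re

lemma conjDiag_mono {m : Type*} [Fintype m] (U : Matrix m m ℂ) {M N : Matrix m m ℂ}
    (h : M ≤ N) (i : m) :
    conjDiag U M i ≤ conjDiag U N i := by
  have h1 : (star U * (N - M) * U).PosSemidef :=
    (Matrix.le_iff.1 h).conjTranspose_mul_mul_same U
  have h2 := (Complex.le_def.1 (h1.diag_nonneg (i := i))).1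
  rw [mul_sub, sub_mul] at h2
  simpa [conjDiag] using h2

lemma sum_conjDiag (U : unitaryGroup n ℂ) (M : Matrix n n ℂ) :
    ∑ i, conjDiag (U : Matrix n n ℂ) M i = rtr M := by
  have h : ∑ i, conjDiag (U : Matrix n n ℂ) M i =
      rtr (star (U : Matrix n n ℂ) * M * (U : Matrix n n ℂ)) := by
    simp [conjDiag, rtr, Matrix.trace]
  rw [h, rtr, Matrix.trace_mul_cycle, Unitary.mul_star_self_of_mem U.2, one_mul, rtr]

lemma conjDiag_add_smul_one (U : unitaryGroup n ℂ) (M : Matrix n n ℂ) (c : ℝ) (i : n) :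
    conjDiag (U : Matrix n n ℂ) (M + c • 1) i = conjDiag (U : Matrix n n ℂ) M i + c := by
  simp [conjDiag, mul_add, add_mul]

lemma rtr_mul_eq_sum_conjDiag {X : Matrix n n ℂ} (hX : X.IsHermitian) (M : Matrix n n ℂ) :
    rtr (X * M) = ∑ i, hX.eigenvalues i * conjDiag (hX.eigenvectorUnitary : Matrix n n ℂ) M i := by
  conv_lhs => rw [hX.spectral_theorem]
  rw [rtr, Unitary.conjStarAlgAut_apply, mul_assoc, mul_assoc, Matrix.trace_mul_comm, mul_assoc]
  simp [Matrix.trace, conjDiag, Matrix.diagonal_mul]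

/-- Bound on a partial diagonal sum, obtained by replacing `Z` with `max Z l`: for this larger
matrix, `mlog (gm A _ s) - (1 - s) • mlog A` is bounded below by `s * r * log l`, so that the partial
sum is controlled by the full trace. -/
lemma sum_conjDiag_mlog_gm_le {A Z : Matrix n n ℂ} (hA : A.PosDef) (hZ : Z.PosDef)
    (U : unitaryGroup n ℂ) (S : Finset n) {s r l : ℝ} (hs : s ∈ Set.Icc (0 : ℝ) 1) (hr : 0 < r)
    (hl : 0 < l) :
    ∑ i ∈ S, conjDiag (U : Matrix n n ℂ) (mlog (gm A (mpow Z r) s) - (1 - s) • mlog A) i ≤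
      s * r * (∑ j, (Real.log (max (hZ.1.eigenvalues j) l) - Real.log l) +
        S.card * Real.log l) := by
  set C : Matrix n n ℂ := cfc (fun x : ℝ => max x l ^ r) Z with hC
  have hlC : l ^ r • 1 ≤ C := by
    rw [← Algebra.algebraMap_eq_smul_one]
    refine algebraMap_le_cfc _ _ _ (fun x _ => ?_) (continuousOn_spectrum _) hZ.1
    exact Real.rpow_le_rpow hl.le (le_max_right _ _) hr.le
  have hZC : mpow Z r ≤ C := by
    refine cfc_mono (fun x hx => ?_) (continuousOn_spectrum _) (continuousOn_spectrum _)
    exact Real.rpow_le_rpow (spectrum_pos hZ hx).le (le_max_left _ _) hr.le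
  have hC' : C.PosDef := by
    rw [← isStrictlyPositive_iff_posDef]
    exact (isStrictlyPositive_iff_posDef.2 (posDef_mpow hZ r)).of_le hZC
  have hlogC : rtr (mlog C) = r * ∑ j, Real.log (max (hZ.1.eigenvalues j) l) := by
    rw [rtr_mlog hC', hC, det_cfc hZ.1, Complex.ofReal_re,
      Real.log_prod fun j _ => (by positivity), Finset.mul_sum]
    exact Finset.sum_congr rfl fun j _ => Real.log_rpow (by positivity) r
  set c := s * (r * Real.log l) with hc
  set N := mlog (gm A C s) - (1 - s) • mlog A - c • 1 with hN
  have hN0 : 0 ≤ N := by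
    have := smul_mlog_le_mlog_gm hA hC' (by positivity) hlC hs
    rw [Real.log_rpow hl] at this
    rw [hN, sub_sub, add_comm, sub_nonneg]
    exact this
  have hNtr : rtr N = s * (r * ∑ j, Real.log (max (hZ.1.eigenvalues j) l)) -
      Fintype.card n * c := by
    have h : rtr N = rtr (mlog (gm A C s)) - (1 - s) * rtr (mlog A) - c * Fintype.card n := by
      simp [hN, rtr, Matrix.trace_sub, Matrix.trace_smul]
    rw [h, rtr_mlog_gm hA hC', hlogC]
    ring
  calc _ ≤ ∑ i ∈ S, (conjDiag (U : Matrix n n ℂ) N i + c) := by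
        refine Finset.sum_le_sum fun i _ => ?_
        rw [← conjDiag_add_smul_one, hN, sub_add_cancel]
        exact conjDiag_mono _ (mlog_gm_sub_le hA (posDef_mpow hZ r) hC' hZC hs) i
    _ ≤ rtr N + S.card * c := by
        rw [Finset.sum_add_distrib, Finset.sum_const, nsmul_eq_mul, ← sum_conjDiag U]
        gcongr
        · exact fun i _ _ => by simpa [conjDiag] using conjDiag_mono (U : Matrix n n ℂ) hN0 i
        · exact Finset.subset_univ S
    _ = _ := by
        rw [hNtr, Finset.sum_sub_distrib, Finset.sum_const, nsmul_eq_mul, Finset.card_univ, hc]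
        ring

end

section

open MeasureTheory

lemma integrableOn_Ioi_ite {g : ℝ → ℝ} {x : ℝ} (hx : 0 < x)
    (hg : IntervalIntegrable g volume 0 x) :
    IntegrableOn (fun l => if l < x then g l else 0) (Set.Ioi 0) := by
  have h : (fun l => if l < x then g l else 0) = (Set.Iio x).indicator g := by
    ext l; simp [Set.indicator]
  rw [h, IntegrableOn, integrable_indicator_iff measurableSet_Iio, IntegrableOn,
    Measure.restrict_restrict measurableSet_Iio, Set.inter_comm, Set.Ioi_inter_Iio]
  exact (intervalIntegrable_iff_integrableOn_Ioo_of_le hx.le).1 hg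

lemma integral_Ioi_ite (g : ℝ → ℝ) {x : ℝ} (hx : 0 < x) :
    ∫ l in Set.Ioi 0, (if l < x then g l else 0) = ∫ l in 0..x, g l := by
  have h : (fun l => if l < x then g l else 0) = (Set.Iio x).indicator g := by
    ext l; simp [Set.indicator]
  rw [h, setIntegral_indicator measurableSet_Iio, Set.Ioi_inter_Iio,
    intervalIntegral.integral_of_le hx.le, integral_Ioc_eq_integral_Ioo]

lemma log_max_sub_log (z l : ℝ) :
    Real.log (max z l) - Real.log l = if l < z then Real.log z - Real.log l else 0 := by
  split_ifs with h
  · rw [max_eq_left h.le]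
  · rw [max_eq_right (not_lt.1 h), sub_self]

lemma sum_mul_le_of_layer_le {ι : Type*} [Fintype ι] {x z p : ι → ℝ} {K : ℝ}
    (hx : ∀ i, 0 < x i) (hz : ∀ i, 0 < z i) (hxz : ∑ i, z i = ∑ i, x i)
    (h : ∀ l > 0, ∑ i with l < x i, p i ≤
      K * (∑ j, (Real.log (max (z j) l) - Real.log l) +
        (Finset.card {i | l < x i} : ℝ) * Real.log l)) :
    ∑ i, x i * p i ≤ K * ∑ i, x i * Real.log (x i) := by
  have hp (i : ι) : IntegrableOn (fun l => if l < x i then p i else 0) (Set.Ioi 0) :=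
    integrableOn_Ioi_ite (g := fun _ => p i) (hx i) (by simp)
  have hlx (i : ι) : IntegrableOn (fun l => if l < x i then Real.log l else 0) (Set.Ioi 0) :=
    integrableOn_Ioi_ite (hx i) intervalIntegral.intervalIntegrable_log'
  have hlz (j : ι) : IntegrableOn
      (fun l => if l < z j then Real.log (z j) - Real.log l else 0) (Set.Ioi 0) :=
    integrableOn_Ioi_ite (hz j) (by simp [intervalIntegral.intervalIntegrable_log'])
  have hmono : ∫ l in Set.Ioi (0 : ℝ), ∑ i, (if l < x i then p i else 0) ≤
      ∫ l in Set.Ioi (0 : ℝ), K * (∑ j, (if l < z j then Real.log (z j) - Real.log l else 0) +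
        ∑ i, (if l < x i then Real.log l else 0)) := by
    refine setIntegral_mono_on (integrable_finsetSum _ fun i _ => hp i)
      (((integrable_finsetSum _ fun j _ => hlz j).add
        (integrable_finsetSum _ fun i _ => hlx i)).const_mul K) measurableSet_Ioi fun l hl => ?_
    have := h l hl
    simp only [log_max_sub_log] at this
    rwa [Finset.sum_filter, ← nsmul_eq_mul, ← Finset.sum_const, Finset.sum_filter] at this
  rw [integral_finsetSum _ fun i _ => hp i, integral_const_mul,
    integral_add (integrable_finsetSum _ fun j _ => hlz j)
      (integrable_finsetSum _ fun i _ => hlx i),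
    integral_finsetSum _ fun j _ => hlz j, integral_finsetSum _ fun i _ => hlx i] at hmono
  have h1 (i : ι) : ∫ l in Set.Ioi 0, (if l < x i then p i else 0) = x i * p i := by
    rw [integral_Ioi_ite (fun _ => p i) (hx i)]
    simp
  have h2 (i : ι) : ∫ l in Set.Ioi 0, (if l < x i then Real.log l else 0) =
      x i * Real.log (x i) - x i := by
    rw [integral_Ioi_ite _ (hx i), integral_log]
    simp
  have h3 (j : ι) : ∫ l in Set.Ioi 0, (if l < z j then Real.log (z j) - Real.log l else 0) =
      z j := by
    rw [integral_Ioi_ite (fun l => Real.log (z j) - Real.log l) (hz j),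
      intervalIntegral.integral_sub (by simp) intervalIntegral.intervalIntegrable_log',
      integral_log]
    simp
  simp only [h1, h2, h3, Finset.sum_sub_distrib, hxz, add_sub_cancel] at hmono
  exact hmono

end

theorem stmt3 {n : Type*} [Fintype n] [DecidableEq n]
    (X Y Z : Matrix n n ℂ) (hX : X.PosDef) (hY : Y.PosDef) (hZ : Z.PosDef)
    (htr : Z.trace = X.trace) (s r : ℝ) (hs : s ∈ Set.Icc (0 : ℝ) 1) (hr : 0 < r) :
    rtr (X * mlog (gm (mpow Y r) (mpow Z r) s)) ≤
      rtr (X * (s • mlog (mpow X r) + (1 - s) • mlog (mpow Y r))) := by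
  have hA := posDef_mpow hY r
  set A := mpow Y r
  have hsum : ∑ i, hZ.1.eigenvalues i = ∑ i, hX.1.eigenvalues i := by
    have := congrArg Complex.re htr
    rw [hZ.1.trace_eq_sum_eigenvalues, hX.1.trace_eq_sum_eigenvalues] at this
    exact_mod_cast this
  have key := sum_mul_le_of_layer_le (K := s * r) hX.eigenvalues_pos hZ.eigenvalues_pos hsum
    fun l hl => sum_conjDiag_mlog_gm_le hA hZ hX.1.eigenvectorUnitary
      {i | l < hX.1.eigenvalues i} hs hr hl
  rw [← rtr_mul_eq_sum_conjDiag, ← rtr_mul_mlog] at key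
  have hL : rtr (X * (mlog (gm A (mpow Z r) s) - (1 - s) • mlog A)) =
      rtr (X * mlog (gm A (mpow Z r) s)) - (1 - s) * rtr (X * mlog A) := by
    simp [rtr, mul_sub]
  have hR : rtr (X * (s • mlog (mpow X r) + (1 - s) • mlog A)) =
      s * r * rtr (X * mlog X) + (1 - s) * rtr (X * mlog A) := by
    rw [mlog_mpow hX]
    simp [rtr, mul_add, mul_assoc]
  rw [hL] at key
  rw [hR]
  linarith
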